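/- arXiv:2509.09401 — 4 statements merged into one kernel-verified Lean document; each statement's English description precedes it below -/
import Mathlib

section
/- For every integer k ≥ 1, setting n = 2k, and every real number d ≠ 0, the integral over ℝ^{n−1} (with respect to (n−1)-dimensional Lebesgue measure) of the function (s₁,…,s_{n−1}) ↦ (∏_{i=1}^{n−1} 1/(2·cosh(sᵢ/2))) · 1/(2·cosh((d − s₁ − ⋯ − s_{n−1})/2)) equals (d / sinh(d/2)) · (∏_{j=1}^{k−1} (d² + (2j)²·π²)) / (2·(n−1)!). -/
open MeasureTheory Real

section

open Filter Topology FourierTransform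

/-- The hyperbolic secant power `(cosh (c w))⁻ⁿ`. -/
noncomputable def sechPow (c : ℝ) (n : ℕ) (w : ℝ) : ℝ := (cosh (c * w))⁻¹ ^ n

lemma continuous_sechPow (c : ℝ) (n : ℕ) : Continuous (sechPow c n) := by
  unfold sechPow
  exact (Continuous.inv₀ (by fun_prop) fun w => (cosh_pos _).ne').pow n

lemma sechPow_nonneg (c : ℝ) (n : ℕ) (w : ℝ) : 0 ≤ sechPow c n w :=
  pow_nonneg (inv_nonneg.2 (cosh_pos _).le) n

lemma one_add_sq_div_two_le_cosh (x : ℝ) : 1 + x ^ 2 / 2 ≤ cosh x := by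
  have h : |x / 2| ≤ |sinh (x / 2)| := by
    rcases le_total 0 (x / 2) with hx | hx
    · rw [abs_of_nonneg hx, abs_of_nonneg (sinh_nonneg_iff.2 hx)]
      exact self_le_sinh_iff.2 hx
    · rw [abs_of_nonpos hx, abs_of_nonpos (sinh_nonpos_iff.2 hx)]
      exact neg_le_neg (sinh_le_self_iff.2 hx)
  have h2 := cosh_two_mul (x / 2)
  have h3 := cosh_sq (x / 2)
  have h4 := sq_le_sq.2 h
  rw [mul_div_cancel₀ x two_ne_zero] at h2
  nlinarith

lemma integrable_inv_cosh : Integrable fun w : ℝ => (cosh w)⁻¹ := by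
  refine (integrable_inv_one_add_sq.const_mul 2).mono'
    (Continuous.inv₀ continuous_cosh fun w => (cosh_pos _).ne').aestronglyMeasurable
    (.of_forall fun w => ?_)
  rw [norm_of_nonneg (inv_nonneg.2 (cosh_pos _).le), ← div_eq_mul_inv, inv_eq_one_div,
    div_le_div_iff₀ (cosh_pos _) (by positivity)]
  linarith [one_add_sq_div_two_le_cosh w]

lemma integrable_sechPow {c : ℝ} (hc : c ≠ 0) {n : ℕ} (hn : n ≠ 0) :
    Integrable (sechPow c n) := by
  refine (integrable_inv_cosh.comp_mul_left' hc).mono'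
    (continuous_sechPow c n).aestronglyMeasurable (.of_forall fun w => ?_)
  rw [norm_of_nonneg (sechPow_nonneg c n w)]
  exact pow_le_of_le_one (inv_nonneg.2 (cosh_pos _).le) (inv_le_one_of_one_le₀ (one_le_cosh _)) hn

lemma hasDerivAt_sechPow (c : ℝ) (n : ℕ) (w : ℝ) :
    HasDerivAt (sechPow c n) (-(n * c) * sinh (c * w) * sechPow c (n + 1) w) w := by
  have h : HasDerivAt (fun w => cosh (c * w)) (sinh (c * w) * c) w := by
    simpa using ((hasDerivAt_id w).const_mul c).cosh
  have hp := (cosh_pos (c * w)).ne'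
  refine ((h.inv hp).pow n).congr_deriv ?_
  rcases n with _ | n
  · simp
  · simp only [sechPow, Nat.add_sub_cancel, Pi.inv_apply, inv_pow]
    field_simp
    ring

lemma hasDerivAt_sinh_mul_sechPow (c : ℝ) (n : ℕ) (w : ℝ) :
    HasDerivAt (fun w => -(n * c) * sinh (c * w) * sechPow c (n + 1) w)
      (c ^ 2 * (n ^ 2 * sechPow c n w - n * (n + 1) * sechPow c (n + 2) w)) w := by
  have h : HasDerivAt (fun w => sinh (c * w)) (cosh (c * w) * c) w := by
    simpa using ((hasDerivAt_id w).const_mul c).sinh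
  refine ((h.const_mul (-(n * c))).mul (hasDerivAt_sechPow c (n + 1) w)).congr_deriv ?_
  have hp := (cosh_pos (c * w)).ne'
  simp only [sechPow, inv_pow]
  push_cast
  field_simp
  rw [sinh_sq]
  ring

lemma integrable_sinh_mul_sechPow {c : ℝ} (hc : c ≠ 0) {n : ℕ} (hn : n ≠ 0) :
    Integrable fun w => -(n * c) * sinh (c * w) * sechPow c (n + 1) w := by
  refine ((integrable_sechPow hc hn).const_mul |n * c|).mono'
    (((continuous_const.mul (by fun_prop)).mul
      (continuous_sechPow c (n + 1))).aestronglyMeasurable) (.of_forall fun w => ?_)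
  have hp := cosh_pos (c * w)
  have hs : |sinh (c * w)| ≤ cosh (c * w) :=
    abs_le_of_sq_le_sq (by rw [cosh_sq]; linarith) hp.le
  rw [norm_mul, norm_mul, norm_neg, norm_of_nonneg (sechPow_nonneg _ _ _), norm_eq_abs,
    norm_eq_abs, mul_assoc]
  gcongr
  calc |sinh (c * w)| * sechPow c (n + 1) w ≤ cosh (c * w) * sechPow c (n + 1) w := by
        gcongr
        exact sechPow_nonneg _ _ _
    _ = sechPow c n w := by
        simp only [sechPow, pow_succ]
        field_simp

lemma fourier_sechPow_add_two {c : ℝ} (hc : c ≠ 0) {n : ℕ} (hn : n ≠ 0) (x : ℝ) :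
    (c : ℂ) ^ 2 * (n * (n + 1)) * 𝓕 (fun w => (sechPow c (n + 2) w : ℂ)) x =
      (c ^ 2 * n ^ 2 + 4 * π ^ 2 * x ^ 2) * 𝓕 (fun w => (sechPow c n w : ℂ)) x := by
  set f : ℝ → ℂ := fun w => (sechPow c n w : ℂ) with hf
  set g : ℝ → ℂ := fun w => (sechPow c (n + 2) w : ℂ) with hg
  set f' : ℝ → ℂ := fun w => ((-(n * c) * sinh (c * w) * sechPow c (n + 1) w : ℝ) : ℂ) with hf'
  have hfi : Integrable f := (integrable_sechPow hc hn).ofReal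
  have hgi : Integrable g := (integrable_sechPow hc (by lia)).ofReal
  have hf'i : Integrable f' := (integrable_sinh_mul_sechPow hc hn).ofReal
  have hd : ∀ w, HasDerivAt f (f' w) w := fun w => (hasDerivAt_sechPow c n w).ofReal_comp
  have hd' : ∀ w, HasDerivAt f'
      ((c ^ 2 * n ^ 2 : ℂ) • f w - (c ^ 2 * (n * (n + 1)) : ℂ) • g w) w :=
    fun w => by
      convert! (hasDerivAt_sinh_mul_sechPow c n w).ofReal_comp using 1
      simp only [hf, hg, smul_eq_mul]
      push_cast
      ring
  have e : deriv f = f' := funext fun w => (hd w).deriv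
  have e' : deriv f' = (c ^ 2 * n ^ 2 : ℂ) • f - (c ^ 2 * (n * (n + 1)) : ℂ) • g :=
    funext fun w => (hd' w).deriv
  have hI : Integrable (deriv f') := by
    rw [e']
    exact (hfi.smul _).sub (hgi.smul _)
  have h1 := congrFun (fourier_deriv hfi (fun w => (hd w).differentiableAt) (e ▸ hf'i)) x
  have h2 := congrFun (fourier_deriv hf'i (fun w => (hd' w).differentiableAt) hI) x
  have h3 : 𝓕 (deriv f') x =
      (c ^ 2 * n ^ 2 : ℂ) * 𝓕 f x - (c ^ 2 * (n * (n + 1)) : ℂ) * 𝓕 g x := by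
    rw [e', fourier_real_eq, fourier_real_eq, fourier_real_eq, ← integral_const_mul,
      ← integral_const_mul, ← integral_sub]
    · congr 1 with v
      simp only [Pi.sub_apply, Pi.smul_apply, Circle.smul_def, smul_eq_mul]
      ring
    · exact ((fourierIntegral_convergent_iff (V := ℝ) x).2 hfi |>.congr
        (.of_forall fun v => by simp [mul_comm])).const_mul _
    · exact ((fourierIntegral_convergent_iff (V := ℝ) x).2 hgi |>.congr
        (.of_forall fun v => by simp [mul_comm])).const_mul _
  rw [e] at h1
  rw [h2, h1] at h3
  simp only [smul_eq_mul] at h3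
  linear_combination h3 - (4 * π ^ 2 * x ^ 2 * 𝓕 f x) * Complex.I_sq


/-- The half hyperbolic secant `1 / (2 cosh (s / 2))`. -/
noncomputable def halfSech (s : ℝ) : ℝ := 1 / (2 * cosh (s / 2))

lemma sigmoid_mul_one_sub_sigmoid (s : ℝ) : sigmoid s * (1 - sigmoid s) = halfSech s ^ 2 := by
  have h := exp_pos (s / 2)
  rw [halfSech, ← sigmoid_neg, sigmoid_def, sigmoid_def, cosh_eq, neg_neg, exp_neg (s / 2),
    exp_neg s, show s = s / 2 + s / 2 by ring, exp_add]
  simp only [add_halves]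
  field_simp
  ring

lemma halfSech_pos (s : ℝ) : 0 < halfSech s := by
  have := cosh_pos (s / 2)
  unfold halfSech; positivity

lemma log_sigmoid (s : ℝ) : log (sigmoid s) = s / 2 + log (halfSech s) := by
  have h : sigmoid s = exp (s / 2) * halfSech s := by
    have h := exp_pos (s / 2)
    rw [halfSech, sigmoid_def, cosh_eq, exp_neg (s / 2),
      exp_neg s, show s = s / 2 + s / 2 by ring, exp_add]
    simp only [add_halves]
    field_simp
  rw [h, log_mul (exp_pos _).ne' (halfSech_pos s).ne', log_exp]

lemma log_one_sub_sigmoid (s : ℝ) : log (1 - sigmoid s) = -(s / 2) + log (halfSech s) := by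
  rw [← sigmoid_neg, log_sigmoid]
  simp [halfSech, neg_div]

lemma betaIntegral_eq_integral_halfSech (z : ℂ) :
    Complex.betaIntegral (1 / 2 + z) (1 / 2 - z) =
      ∫ s : ℝ, Complex.exp (z * s) * halfSech s := by
  rw [Complex.betaIntegral, intervalIntegral.integral_of_le zero_le_one,
    integral_Ioc_eq_integral_Ioo, ← range_sigmoid, ← Set.image_univ,
    integral_image_eq_integral_abs_deriv_smul MeasurableSet.univ
      (fun x _ => (hasDerivAt_sigmoid x).hasDerivWithinAt) sigmoid_injective.injOn,
    setIntegral_univ]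
  congr 1 with s
  have h0 := sigmoid_pos s
  have h1 : 0 < 1 - sigmoid s := sub_pos.2 (sigmoid_lt_one s)
  have hh := halfSech_pos s
  rw [abs_of_pos (mul_pos h0 h1), ← Complex.ofReal_one, ← Complex.ofReal_sub,
    Complex.cpow_def_of_ne_zero (Complex.ofReal_ne_zero.2 h0.ne'),
    Complex.cpow_def_of_ne_zero (Complex.ofReal_ne_zero.2 h1.ne'),
    ← Complex.ofReal_log h0.le, ← Complex.ofReal_log h1.le, sigmoid_mul_one_sub_sigmoid,
    log_sigmoid, log_one_sub_sigmoid, ← Complex.exp_add, Complex.real_smul]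
  have e : (halfSech s : ℂ) = Complex.exp (log (halfSech s)) := by
    rw [← Complex.ofReal_exp, exp_log hh]
  rw [Complex.ofReal_pow, e, ← Complex.exp_nat_mul, ← Complex.exp_add, ← Complex.exp_add]
  congr 1
  push_cast
  ring

lemma fourier_halfSech (w : ℝ) :
    𝓕 (fun s => (halfSech s : ℂ)) w = (π / cosh (2 * π ^ 2 * w) : ℝ) := by
  set z : ℂ := -(2 * π * w : ℝ) * Complex.I with hz
  have hre : z.re = 0 := by simp [hz]
  have h := betaIntegral_eq_integral_halfSech z
  have hG := Complex.Gamma_mul_Gamma_eq_betaIntegral (s := 1 / 2 + z) (t := 1 / 2 - z)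
    (by simp [hre]) (by simp [hre])
  have hR := Complex.Gamma_mul_Gamma_one_sub (1 / 2 + z)
  rw [show 1 - (1 / 2 + z) = 1 / 2 - z by ring, hG, h,
    show 1 / 2 + z + (1 / 2 - z) = 1 by ring, Complex.Gamma_one, one_mul] at hR
  rw [fourier_real_eq_integral_exp_smul]
  convert! hR using 1
  · congr 1 with s
    rw [smul_eq_mul, hz]
    congr 2
    push_cast
    ring
  · rw [show (π : ℂ) * (1 / 2 + z) = (π * z) + π / 2 by ring, Complex.sin_add_pi_div_two,
      hz, show (π : ℂ) * (-((2 * π * w : ℝ) : ℂ) * Complex.I) =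
        -((2 * π ^ 2 * w : ℝ) : ℂ) * Complex.I by push_cast; ring, neg_mul, Complex.cos_neg, Complex.cos_mul_I]
    push_cast
    rfl

lemma halfSech_eq_sechPow (s : ℝ) : halfSech s = 1 / 2 * sechPow (1 / 2) 1 s := by
  simp only [halfSech, sechPow, pow_one]
  rw [show (1 : ℝ) / 2 * s = s / 2 by ring]
  field_simp

lemma integrable_halfSech : Integrable halfSech := by
  rw [funext halfSech_eq_sechPow]
  exact (integrable_sechPow (by norm_num) one_ne_zero).const_mul _

lemma halfSech_le_one (s : ℝ) : halfSech s ≤ 1 := by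
  rw [halfSech, div_le_one (mul_pos two_pos (cosh_pos _))]
  linarith [one_le_cosh (s / 2)]

lemma continuous_halfSech : Continuous halfSech := by
  unfold halfSech
  exact continuous_const.div (by fun_prop) fun s => (mul_pos two_pos (cosh_pos _)).ne'

lemma tendsto_log_cosh_sub (a : ℝ) :
    Tendsto (fun s => log (cosh (s / 2)) - log (cosh ((a - s) / 2))) atTop (𝓝 (a / 2)) := by
  have key : ∀ s, log (cosh (s / 2)) - log (cosh ((a - s) / 2)) =
      a / 2 + (log (1 + exp (-s)) - log (1 + exp (a - s))) := by
    intro s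
    have h1 : cosh (s / 2) = exp (s / 2) * (1 + exp (-s)) / 2 := by
      rw [cosh_eq, mul_add, ← exp_add]; ring_nf
    have h2 : cosh ((a - s) / 2) = exp ((s - a) / 2) * (1 + exp (a - s)) / 2 := by
      rw [cosh_eq, mul_add, ← exp_add]; ring_nf
    have p1 := exp_pos (-s)
    have p2 := exp_pos (a - s)
    rw [h1, h2, log_div (by positivity) two_ne_zero, log_div (by positivity) two_ne_zero,
      log_mul (by positivity) (by positivity), log_mul (by positivity) (by positivity),
      log_exp, log_exp]
    ring
  simp_rw [key]
  have t : ∀ b : ℝ, Tendsto (fun s => log (1 + exp (b - s))) atTop (𝓝 0) := fun b => by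
    have : Tendsto (fun s => 1 + exp (b - s)) atTop (𝓝 (1 + 0)) :=
      tendsto_const_nhds.add (tendsto_exp_atBot.comp (tendsto_const_nhds.add_atBot tendsto_neg_atTop_atBot))
    simpa using this.log (by norm_num)
  simpa using tendsto_const_nhds.add ((t 0).sub (t a))

lemma integral_halfSech_mul_halfSech {d : ℝ} (hd : d ≠ 0) :
    ∫ s, halfSech s * halfSech (d - s) = d / (2 * sinh (d / 2)) := by
  have hs : sinh (d / 2) ≠ 0 := sinh_ne_zero.2 (by simpa)
  have hder : ∀ s, HasDerivAt
      (fun s => (2 * sinh (d / 2))⁻¹ * (log (cosh (s / 2)) - log (cosh ((d - s) / 2))))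
      (halfSech s * halfSech (d - s)) s := by
    intro s
    have h1 := (((hasDerivAt_id s).div_const 2).cosh).log (cosh_pos _).ne'
    have h2 := ((((hasDerivAt_id s).const_sub d).div_const 2).cosh).log (cosh_pos _).ne'
    refine ((h1.sub h2).const_mul (2 * sinh (d / 2))⁻¹).congr_deriv ?_
    have p1 := (cosh_pos (s / 2)).ne'
    have p2 := (cosh_pos ((d - s) / 2)).ne'
    have hadd : sinh (d / 2) =
        sinh (s / 2) * cosh ((d - s) / 2) + cosh (s / 2) * sinh ((d - s) / 2) := by
      rw [← sinh_add]; ring_nf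
    simp only [halfSech, id]
    field_simp
    linear_combination -hadd
  have hint : Integrable fun s => halfSech s * halfSech (d - s) := by
    refine integrable_halfSech.mul_bdd (c := 1) (continuous_halfSech.comp (by fun_prop)).aestronglyMeasurable
      (.of_forall fun s => ?_)
    rw [norm_of_nonneg (halfSech_pos _).le]
    exact halfSech_le_one _
  have htop := (tendsto_log_cosh_sub d).const_mul (2 * sinh (d / 2))⁻¹
  have hbot : Tendsto (fun s => (2 * sinh (d / 2))⁻¹ *
      (log (cosh (s / 2)) - log (cosh ((d - s) / 2)))) atBot
      (𝓝 ((2 * sinh (d / 2))⁻¹ * (-d / 2))) := by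
    refine Tendsto.const_mul _ (((tendsto_log_cosh_sub (-d)).comp tendsto_neg_atBot_atTop).congr
      fun s => ?_)
    simp only [Function.comp]
    rw [← cosh_neg (s / 2), ← cosh_neg ((d - s) / 2)]
    ring_nf
  rw [integral_of_hasDerivAt_of_tendsto hder hint hbot htop]
  field_simp
  ring

/-- The iterated convolution of `halfSech`, with `card ι + 1` factors. -/
noncomputable def halfSechConv (ι : Type*) [Fintype ι] (d : ℝ) : ℝ :=
  ∫ s : ι → ℝ, (∏ i, halfSech (s i)) * halfSech (d - ∑ i, s i)

section

variable (ι : Type*) [Fintype ι]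

lemma integrable_prod_halfSech : Integrable fun s : ι → ℝ => ∏ i, halfSech (s i) :=
  Integrable.fintype_prod fun _ => integrable_halfSech

lemma integrable_halfSechConv_kernel :
    Integrable (fun p : (ι → ℝ) × ℝ => (∏ i, halfSech (p.1 i)) * halfSech (p.2 - ∑ i, p.1 i))
      (volume.prod volume) := by
  have hm : MeasurePreserving (fun p : (ι → ℝ) × ℝ => (p.1, p.2 - ∑ i, p.1 i))
      (volume.prod volume) (volume.prod volume) :=
    (MeasurePreserving.id (volume : Measure (ι → ℝ))).skew_product
      (g := fun s d => d - ∑ i, s i) (by fun_prop)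
      (.of_forall fun s => (measurePreserving_sub_right volume _).map_eq)
  exact hm.integrable_comp_of_integrable ((integrable_prod_halfSech ι).mul_prod integrable_halfSech)

lemma integrable_halfSechConv : Integrable (halfSechConv ι) :=
  (integrable_halfSechConv_kernel ι).integral_prod_right

lemma continuous_halfSechConv : Continuous (halfSechConv ι) := by
  have hc := continuous_halfSech
  refine continuous_of_dominated (bound := fun s : ι → ℝ => ∏ i, halfSech (s i)) (fun d => ?_)
    (fun d => .of_forall fun s => ?_) (integrable_prod_halfSech ι) (.of_forall fun s => ?_)
  · exact (by fun_prop : Continuous fun s : ι → ℝ =>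
      (∏ i, halfSech (s i)) * halfSech (d - ∑ i, s i)).aestronglyMeasurable
  · have hp : 0 ≤ ∏ i, halfSech (s i) := Finset.prod_nonneg fun i _ => (halfSech_pos _).le
    rw [norm_of_nonneg (mul_nonneg hp (halfSech_pos _).le)]
    exact mul_le_of_le_one_right hp (halfSech_le_one _)
  · fun_prop

lemma fourier_halfSechConv (w : ℝ) :
    𝓕 (fun d => (halfSechConv ι d : ℂ)) w =
      𝓕 (fun s => (halfSech s : ℂ)) w ^ (Fintype.card ι + 1) := by
  simp only [fourier_real_eq_integral_exp_smul, smul_eq_mul]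
  set e : ℝ → ℂ := fun v => Complex.exp ((-2 * π * v * w : ℝ) * Complex.I) with he
  have hadd : ∀ a b, e (a + b) = e a * e b := fun a b => by
    simp only [he, ← Complex.exp_add]
    congr 1
    push_cast
    ring
  have hsum : ∀ s : ι → ℝ, e (∑ i, s i) = ∏ i, e (s i) := fun s => by
    simp only [he, ← Complex.exp_sum]
    congr 1
    push_cast
    rw [Finset.mul_sum, Finset.sum_mul, Finset.sum_mul]
  have hnorm : ∀ v, ‖e v‖ = 1 := fun v => Complex.norm_exp_ofReal_mul_I _
  have hec : Continuous e := by fun_prop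
  have hint : Integrable (Function.uncurry fun (d : ℝ) (s : ι → ℝ) =>
      e d * (((∏ i, halfSech (s i)) * halfSech (d - ∑ i, s i) : ℝ) : ℂ))
      (volume.prod volume) :=
    ((integrable_halfSechConv_kernel ι).swap.ofReal (𝕜 := ℂ)).bdd_mul (c := 1)
      (f := fun p : ℝ × (ι → ℝ) => e p.1)
      (hec.comp continuous_fst).aestronglyMeasurable (.of_forall fun p => (hnorm _).le)
  calc ∫ d, e d * (halfSechConv ι d : ℂ)
      = ∫ d, ∫ s : ι → ℝ, e d * (((∏ i, halfSech (s i)) * halfSech (d - ∑ i, s i) : ℝ) : ℂ) := by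
        congr 1 with d
        rw [integral_const_mul, halfSechConv, integral_complex_ofReal]
    _ = ∫ s : ι → ℝ, ∫ d, e d * (((∏ i, halfSech (s i)) * halfSech (d - ∑ i, s i) : ℝ) : ℂ) :=
        integral_integral_swap hint
    _ = ∫ s : ι → ℝ, (∏ i, e (s i) * (halfSech (s i) : ℂ)) * ∫ d, e d * (halfSech d : ℂ) := by
        congr 1 with s
        rw [← integral_const_mul, ← integral_add_right_eq_self _ (∑ i, s i)]
        congr 1 with d
        rw [Finset.prod_mul_distrib, ← hsum, hadd, add_sub_cancel_right]
        push_cast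
        ring
    _ = (∫ d, e d * (halfSech d : ℂ)) ^ (Fintype.card ι + 1) := by
        rw [integral_mul_const,
          integral_fintype_prod_volume_eq_pow (fun v => e v * (halfSech v : ℂ)), pow_succ]

lemma halfSechConv_eq_fourier_sechPow (d : ℝ) :
    (halfSechConv ι d : ℂ) = π ^ (Fintype.card ι + 1) *
      𝓕 (fun w => (sechPow (2 * π ^ 2) (Fintype.card ι + 1) w : ℂ)) (-d) := by
  have hF : 𝓕 (fun d => (halfSechConv ι d : ℂ)) = fun w =>
      (π : ℂ) ^ (Fintype.card ι + 1) * (sechPow (2 * π ^ 2) (Fintype.card ι + 1) w : ℂ) := by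
    ext w
    rw [fourier_halfSechConv, fourier_halfSech, sechPow, div_eq_mul_inv]
    push_cast
    rw [mul_pow]
  have hi := congrFun ((Complex.continuous_ofReal.comp
    (continuous_halfSechConv ι)).fourierInv_fourier_eq (integrable_halfSechConv ι).ofReal
    (by
      change Integrable (𝓕 (fun d => (halfSechConv ι d : ℂ)))
      rw [hF]
      exact ((integrable_sechPow (by positivity) (by lia)).ofReal).const_mul _)) d
  change 𝓕⁻ (𝓕 (fun d => (halfSechConv ι d : ℂ))) d = (halfSechConv ι d : ℂ) at hi
  rw [← hi, hF, fourierInv_eq_fourier_neg, fourier_real_eq, fourier_real_eq, ← integral_const_mul]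
  congr 1 with v
  simp only [Circle.smul_def, smul_eq_mul]
  ring

end

lemma halfSechConv_add_two (m : ℕ) (d : ℝ) :
    ((m : ℝ) + 1) * (m + 2) * halfSechConv (Fin (m + 2)) d =
      (d ^ 2 + (m + 1) ^ 2 * π ^ 2) * halfSechConv (Fin m) d := by
  have h := fourier_sechPow_add_two (c := 2 * π ^ 2) (by positivity) (Nat.succ_ne_zero m) (-d)
  have h1 := halfSechConv_eq_fourier_sechPow (Fin m) d
  have h2 := halfSechConv_eq_fourier_sechPow (Fin (m + 2)) d
  simp only [Fintype.card_fin] at h1 h2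
  rw [show m + 2 + 1 = m + 1 + 2 by ring] at h2
  have hp : (4 * π ^ 2 : ℂ) ≠ 0 := by simp [pi_ne_zero]
  apply Complex.ofReal_injective
  refine mul_left_cancel₀ hp ?_
  push_cast at h ⊢
  rw [h1, h2]
  rw [Nat.succ_eq_add_one] at h
  linear_combination (π : ℂ) ^ (m + 1) * h

lemma halfSechConv_fin_one {d : ℝ} (hd : d ≠ 0) :
    halfSechConv (Fin 1) d = d / (2 * sinh (d / 2)) := by
  rw [← integral_halfSech_mul_halfSech hd, halfSechConv]
  refine (((volume_preserving_funUnique (Fin 1) ℝ).symm _).integral_comp' _).symm.trans ?_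
  simp

lemma halfSechConv_odd (k : ℕ) {d : ℝ} (hd : d ≠ 0) :
    halfSechConv (Fin (2 * k + 1)) d = d / sinh (d / 2) *
      (∏ j ∈ Finset.Icc 1 k, (d ^ 2 + (2 * (j : ℝ)) ^ 2 * π ^ 2)) /
        (2 * ((2 * k + 1).factorial : ℝ)) := by
  induction k with
  | zero =>
    have := halfSechConv_fin_one hd
    simp only [mul_zero, zero_add, this]
    simp [div_div, mul_comm]
  | succ k ih =>
    have h := halfSechConv_add_two (2 * k + 1) d
    rw [ih] at h
    rw [show 2 * (k + 1) + 1 = 2 * k + 1 + 2 by ring, Finset.prod_Icc_succ_top (by lia),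
      Nat.factorial_succ, Nat.factorial_succ]
    have hs : sinh (d / 2) ≠ 0 := sinh_ne_zero.2 (by simpa)
    have hf : ((2 * k + 1).factorial : ℝ) ≠ 0 := by positivity
    push_cast at h ⊢
    have h1 : (2 * k + 1 + 1 : ℝ) * (2 * k + 1 + 2) ≠ 0 := by positivity
    refine mul_left_cancel₀ h1 (h.trans ?_)
    have h2 : (2 * k + 1 + 1 : ℝ) ≠ 0 := by positivity
    have h3 : (2 * k + 1 + 1 + 1 : ℝ) ≠ 0 := by positivity
    field_simp
    ring

end

/-- The Mirzakhani volume `V_{𝔸ₙ}(d)` of the moduli space of hyperbolic `n`-crowns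
with fixed neck length `d ≠ 0`, for even `n = 2k`. -/
theorem crown_volume_fixed_neck_even (k : ℕ) (hk : 1 ≤ k) (d : ℝ) (hd : d ≠ 0) :
    (∫ s : Fin (2 * k - 1) → ℝ,
        (∏ i, 1 / (2 * Real.cosh (s i / 2))) *
          (1 / (2 * Real.cosh ((d - ∑ i, s i) / 2))))
      = d / Real.sinh (d / 2) *
          (∏ j ∈ Finset.Icc 1 (k - 1), (d ^ 2 + (2 * (j : ℝ)) ^ 2 * Real.pi ^ 2)) /
          (2 * (Nat.factorial (2 * k - 1) : ℝ)) := by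
  obtain ⟨k, rfl⟩ := Nat.exists_eq_add_of_le' hk
  exact halfSechConv_odd k hd
end

section
/- For every integer k ≥ 0, setting n = 2k+1, and every real number d, the integral over ℝ^{n−1} (with respect to (n−1)-dimensional Lebesgue measure) of the function (s₁,…,s_{n−1}) ↦ (∏_{i=1}^{n−1} 1/(2·cosh(sᵢ/2))) · 1/(2·cosh((d − s₁ − ⋯ − s_{n−1})/2)) equals (1 / cosh(d/2)) · (∏_{j=1}^{k} (d² + (2j−1)²·π²)) / (2·(n−1)!). -/
open MeasureTheory Real

lemma sigmoid_mul_sigmoid_neg (s : ℝ) :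
    sigmoid s * sigmoid (-s) = (1 / (2 * cosh (s / 2))) ^ 2 := by
  have h : exp s = exp (s / 2) ^ 2 := by rw [← exp_nat_mul]; congr 1; push_cast; ring
  have h' : exp (-s) = (exp (s / 2) ^ 2)⁻¹ := by rw [exp_neg, h]
  have := exp_pos (s / 2)
  rw [sigmoid_def, sigmoid_def, neg_neg, h, h', cosh_eq, exp_neg]
  field_simp
  ring

lemma sigmoid_cpow_mul_sigmoid_neg_cpow (t s : ℝ) :
    (sigmoid s : ℂ) ^ (1 / 2 + t * Complex.I) * (sigmoid (-s) : ℂ) ^ (1 / 2 - t * Complex.I)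
      = ((1 / (2 * cosh (s / 2)) : ℝ) : ℂ) * Complex.exp (t * s * Complex.I) := by
  have hp := sigmoid_pos s
  have hn := sigmoid_pos (-s)
  have hsub : log (sigmoid s) - log (sigmoid (-s)) = s := by
    rw [← sigmoid_mul_rexp_neg, log_mul hp.ne' (exp_pos _).ne', log_exp]; ring
  have hf : 0 < 1 / (2 * cosh (s / 2)) := by have := cosh_pos (s / 2); positivity
  have hadd : log (sigmoid s) + log (sigmoid (-s)) = 2 * log (1 / (2 * cosh (s / 2))) := by
    rw [← log_mul hp.ne' hn.ne', sigmoid_mul_sigmoid_neg, log_pow]; norm_num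
  rw [Complex.cpow_def_of_ne_zero (by exact_mod_cast hp.ne'),
    Complex.cpow_def_of_ne_zero (by exact_mod_cast hn.ne'), ← Complex.ofReal_log hp.le,
    ← Complex.ofReal_log hn.le, ← Complex.exp_add]
  have he : ((1 / (2 * cosh (s / 2)) : ℝ) : ℂ)
      = Complex.exp (log (1 / (2 * cosh (s / 2))) : ℝ) := by
    rw [← Complex.ofReal_exp, exp_log hf]
  rw [he, ← Complex.exp_add]
  congr 1
  have h1 : log (sigmoid s) = log (1 / (2 * cosh (s / 2))) + s / 2 := by linarith
  have h2 : log (sigmoid (-s)) = log (1 / (2 * cosh (s / 2))) - s / 2 := by linarith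
  rw [h1, h2]
  push_cast
  ring

lemma integral_inv_two_cosh_mul_cexp (t : ℝ) :
    ∫ s : ℝ, ((1 / (2 * cosh (s / 2)) : ℝ) : ℂ) * Complex.exp (t * s * Complex.I)
      = ((π / cosh (π * t) : ℝ) : ℂ) := by
  set u : ℂ := 1 / 2 + t * Complex.I with hu
  have hv : 1 - u = 1 / 2 - t * Complex.I := by rw [hu]; ring
  have hB : Complex.betaIntegral u (1 - u) = ((π / cosh (π * t) : ℝ) : ℂ) := by
    have h := Complex.Gamma_mul_Gamma_eq_betaIntegral (s := u) (t := 1 - u)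
      (by simp [hu]) (by simp [hu]; norm_num)
    rw [Complex.Gamma_mul_Gamma_one_sub, add_sub_cancel, Complex.Gamma_one, one_mul] at h
    rw [← h]
    have : (π : ℂ) * u = (π * t : ℂ) * Complex.I + π / 2 := by rw [hu]; ring
    rw [this, Complex.sin_add_pi_div_two, Complex.cos_mul_I]
    push_cast
    rfl
  rw [← hB, Complex.betaIntegral, intervalIntegral.integral_of_le zero_le_one,
    integral_Ioc_eq_integral_Ioo, ← range_sigmoid, ← Set.image_univ,
    integral_image_eq_integral_abs_deriv_smul MeasurableSet.univ
      (fun x _ => (hasDerivAt_sigmoid x).hasDerivWithinAt) sigmoid_injective.injOn,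
    setIntegral_univ]
  refine integral_congr_ae (Filter.Eventually.of_forall fun s => ?_)
  have hp := sigmoid_pos s
  have hn := sigmoid_pos (-s)
  have hp' : (sigmoid s : ℂ) ≠ 0 := by exact_mod_cast hp.ne'
  have hn' : (sigmoid (-s) : ℂ) ≠ 0 := by exact_mod_cast hn.ne'
  have h1 : (1 - (sigmoid s : ℂ)) = (sigmoid (-s) : ℂ) := by rw [sigmoid_neg]; push_cast; rfl
  simp only [← sigmoid_neg]
  rw [h1, abs_of_pos (mul_pos hp hn), ← sigmoid_cpow_mul_sigmoid_neg_cpow,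
    ← hv, ← hu, Complex.cpow_sub u 1 hp',
    Complex.cpow_sub (1 - u) 1 hn', Complex.real_smul, Complex.cpow_one, Complex.cpow_one]
  push_cast
  field_simp

lemma integrable_inv_two_cosh : Integrable fun s : ℝ => 1 / (2 * cosh (s / 2)) := by
  have h : Integrable fun s : ℝ => ((1 / (2 * cosh (s / 2)) : ℝ) : ℂ) := by
    by_contra hn
    have h0 := integral_inv_two_cosh_mul_cexp 0
    simp only [Complex.ofReal_zero, zero_mul, Complex.exp_zero, mul_one, mul_zero, cosh_zero,
      div_one] at h0
    rw [integral_undef hn] at h0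
    exact pi_ne_zero (by exact_mod_cast h0.symm)
  exact h.re

lemma continuous_inv_two_cosh : Continuous fun s : ℝ => 1 / (2 * cosh (s / 2)) :=
  continuous_const.div (by fun_prop) fun s => by have := cosh_pos (s / 2); positivity

lemma norm_cexp_mul_mul_I (t s : ℝ) : ‖Complex.exp (t * s * Complex.I)‖ = 1 := by
  rw [← Complex.ofReal_mul]; exact Complex.norm_exp_ofReal_mul_I _

lemma abs_inv_two_cosh_le (s : ℝ) : |1 / (2 * cosh (s / 2))| ≤ 1 := by
  have := one_le_cosh (s / 2)
  rw [abs_of_nonneg (by positivity), div_le_one (by positivity)]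
  linarith

lemma integrable_inv_two_cosh_pow_succ_mul_cexp (n : ℕ) (t : ℝ) :
    Integrable fun s : ℝ =>
      ((1 / (2 * cosh (s / 2)) : ℝ) : ℂ) ^ (n + 1) * Complex.exp (t * s * Complex.I) := by
  have hc := continuous_inv_two_cosh
  have hc' : Continuous fun s : ℝ => ((1 / (2 * cosh (s / 2)) : ℝ) : ℂ) :=
    Complex.continuous_ofReal.comp hc
  refine Integrable.mul_bdd (c := 1) ?_ (by fun_prop)
    (.of_forall fun s => (norm_cexp_mul_mul_I t s).le)
  simp_rw [pow_succ]
  refine integrable_inv_two_cosh.ofReal.bdd_mul (c := 1) (hc'.pow n).aestronglyMeasurable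
    (.of_forall fun s => ?_)
  rw [norm_pow, Complex.norm_real]
  exact pow_le_one₀ (norm_nonneg _) (abs_inv_two_cosh_le s)

lemma hasDerivAt_inv_two_cosh (s : ℝ) :
    HasDerivAt (fun s : ℝ => 1 / (2 * cosh (s / 2)))
      (-sinh (s / 2) * (1 / (2 * cosh (s / 2))) ^ 2) s := by
  have hc := cosh_pos (s / 2)
  have h := ((((hasDerivAt_id s).div_const 2).cosh).const_mul 2).inv
    (by simp only [id]; positivity)
  simp only [id] at h
  convert! h using 1
  · ext; simp
  · field_simp

/-- Integrating by parts twice relates the Fourier transforms of the powers of `sech`. -/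
lemma integral_inv_two_cosh_pow_mul_cexp_recurrence (n : ℕ) (t : ℝ) :
    ((n : ℂ) + 1) * (n + 2) * ∫ s : ℝ,
        ((1 / (2 * cosh (s / 2)) : ℝ) : ℂ) ^ (n + 3) * Complex.exp (t * s * Complex.I)
      = (t ^ 2 + (n + 1) ^ 2 / 4) * ∫ s : ℝ,
        ((1 / (2 * cosh (s / 2)) : ℝ) : ℂ) ^ (n + 1) * Complex.exp (t * s * Complex.I) := by
  set f : ℝ → ℂ := fun s => ((1 / (2 * cosh (s / 2)) : ℝ) : ℂ) with hf
  set S : ℝ → ℂ := fun s => ((sinh (s / 2) : ℝ) : ℂ) with hS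
  set e : ℝ → ℂ := fun s => Complex.exp (t * s * Complex.I) with he
  have hdf (s : ℝ) : HasDerivAt f (-S s * f s ^ 2) s := by
    have := (hasDerivAt_inv_two_cosh s).ofReal_comp
    convert! this using 1
    simp [hf, hS]
  have hdS (s : ℝ) : HasDerivAt S ((cosh (s / 2) : ℝ) * (1 / 2)) s := by
    have := (((hasDerivAt_id s).div_const 2).sinh).ofReal_comp
    convert! this using 1
    simp
  have hde (s : ℝ) : HasDerivAt e (e s * (t * Complex.I)) s := by
    have : HasDerivAt (fun s : ℝ => (t : ℂ) * s * Complex.I) (t * Complex.I) s := by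
      simpa using (((hasDerivAt_id s).ofReal_comp).const_mul (t : ℂ)).mul_const Complex.I
    exact this.cexp
  have hfc (s : ℝ) : f s * ((cosh (s / 2) : ℝ) : ℂ) = 1 / 2 := by
    have := (cosh_pos (s / 2)).ne'
    simp only [hf]; rw [← Complex.ofReal_mul]
    rw [show 1 / (2 * cosh (s / 2)) * cosh (s / 2) = 1 / 2 by field_simp]; simp
  have hSc (s : ℝ) : S s ^ 2 = ((cosh (s / 2) : ℝ) : ℂ) ^ 2 - 1 := by
    simp only [hS]; rw [← Complex.ofReal_pow, sinh_sq]; push_cast; rfl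
  have hi1 : Integrable fun s => f s ^ (n + 1) * e s :=
    integrable_inv_two_cosh_pow_succ_mul_cexp n t
  have hi3 : Integrable fun s => f s ^ (n + 3) * e s :=
    integrable_inv_two_cosh_pow_succ_mul_cexp (n + 2) t
  have hcf : Continuous f := Complex.continuous_ofReal.comp continuous_inv_two_cosh
  have hiS : Integrable fun s => (S s * f s) * (f s ^ (n + 1) * e s) := by
    refine hi1.bdd_mul (c := 1) (by fun_prop) (.of_forall fun s => ?_)
    have hc := cosh_pos (s / 2)
    have hsc : |sinh (s / 2)| ≤ cosh (s / 2) := by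
      rw [← sq_le_sq₀ (abs_nonneg _) hc.le, sq_abs, sinh_sq]; linarith
    rw [← Complex.ofReal_mul, Complex.norm_real, norm_eq_abs, abs_mul,
      abs_of_pos (show 0 < 1 / (2 * cosh (s / 2)) by positivity), mul_one_div,
      div_le_one (by positivity)]
    linarith
  have hFint : ∫ s, (((n + 1) ^ 2 / 4 + t ^ 2) * (f s ^ (n + 1) * e s)
      - (n + 1) * (n + 2) * (f s ^ (n + 3) * e s)) = 0 := by
    refine integral_eq_zero_of_hasDerivAt_of_integrable
      (f := fun s => -(n + 1) * ((S s * f s) * (f s ^ (n + 1) * e s))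
        - t * Complex.I * (f s ^ (n + 1) * e s)) (fun s => ?_)
      ((hi1.const_mul _).sub (hi3.const_mul _)) ((hiS.const_mul _).sub (hi1.const_mul _))
    have hp := ((hdf s).pow (n + 1)).mul (hde s)
    convert! (((((hdS s).mul (hdf s)).mul hp).const_mul (-(n + 1) : ℂ)).sub
      (hp.const_mul (t * Complex.I))) using 1
    simp only [Pi.mul_apply, Pi.pow_apply, Nat.add_sub_cancel, Nat.cast_add, Nat.cast_one]
    have h : S s ^ 2 * f s ^ 2 = 1 / 4 - f s ^ 2 := by
      rw [hSc]
      linear_combination (f s * (cosh (s / 2) : ℝ) + 1 / 2) * hfc s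
    linear_combination f s ^ (n + 1) * e s * ((n + 1) / 2 * hfc s - (n + 1) * (n + 2) * h
      + t ^ 2 * Complex.I_sq)
  rw [integral_sub (hi1.const_mul _) (hi3.const_mul _), integral_const_mul, integral_const_mul]
    at hFint
  linear_combination -hFint

lemma integral_inv_two_cosh_pow_odd_mul_cexp (k : ℕ) (t : ℝ) :
    ∫ s : ℝ, ((1 / (2 * cosh (s / 2)) : ℝ) : ℂ) ^ (2 * k + 1) * Complex.exp (t * s * Complex.I)
      = ((π / cosh (π * t) * (∏ j ∈ Finset.Icc 1 k, (t ^ 2 + (2 * (j : ℝ) - 1) ^ 2 / 4))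
        / (Nat.factorial (2 * k) : ℝ) : ℝ) : ℂ) := by
  induction k with
  | zero => simpa using integral_inv_two_cosh_mul_cexp t
  | succ k ih =>
    have h := integral_inv_two_cosh_pow_mul_cexp_recurrence (2 * k) t
    rw [ih] at h
    have h1 : (((2 * k : ℕ) : ℂ) + 1) * ((2 * k : ℕ) + 2) ≠ 0 := by norm_cast
    refine mul_left_cancel₀ h1 (h.trans ?_)
    rw [Finset.prod_Icc_succ_top (by omega), show 2 * (k + 1) = 2 * k + 1 + 1 by ring,
      Nat.factorial_succ, Nat.factorial_succ]
    have h2 : ((Nat.factorial (2 * k) : ℕ) : ℂ) ≠ 0 := by exact_mod_cast Nat.factorial_ne_zero _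
    have h3 : ((2 * k : ℕ) : ℂ) + 1 ≠ 0 := by norm_cast
    have h4 : ((2 * k : ℕ) : ℂ) + 1 + 1 ≠ 0 := by norm_cast
    push_cast at h1 h3 h4 ⊢
    field_simp
    ring

lemma inv_two_cosh_eq_integral (x : ℝ) :
    ((1 / (2 * cosh (x / 2)) : ℝ) : ℂ) = (2 * π : ℂ)⁻¹ * ∫ y : ℝ,
      ((1 / (2 * cosh (y / 2)) : ℝ) : ℂ) * Complex.exp ((x / (2 * π) : ℝ) * y * Complex.I) := by
  have hc := (cosh_pos (x / 2)).ne'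
  rw [integral_inv_two_cosh_mul_cexp, show π * (x / (2 * π)) = x / 2 by field_simp]
  norm_cast
  field_simp

lemma integral_prod_inv_two_cosh_mul_cexp (ι : Type*) [Fintype ι] (y : ℝ) :
    ∫ s : ι → ℝ, ∏ i, (((1 / (2 * cosh (s i / 2)) : ℝ) : ℂ)
        * Complex.exp ((-(y / (2 * π)) : ℝ) * s i * Complex.I))
      = (2 * π * ((1 / (2 * cosh (y / 2)) : ℝ) : ℂ)) ^ Fintype.card ι := by
  rw [integral_fintype_prod_volume_eq_pow (fun x : ℝ => ((1 / (2 * cosh (x / 2)) : ℝ) : ℂ)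
        * Complex.exp ((-(y / (2 * π)) : ℝ) * x * Complex.I)), integral_inv_two_cosh_mul_cexp,
    show π * -(y / (2 * π)) = -(y / 2) by field_simp, cosh_neg]
  have hc := (cosh_pos (y / 2)).ne'
  congr 1
  norm_cast
  field_simp

lemma integral_prod_inv_two_cosh_eq_integral_pow (ι : Type*) [Fintype ι] (d : ℝ) :
    ∫ s : ι → ℝ, (∏ i, ((1 / (2 * cosh (s i / 2)) : ℝ) : ℂ)) *
        ((1 / (2 * cosh ((d - ∑ i, s i) / 2)) : ℝ) : ℂ)
      = (2 * π : ℂ)⁻¹ * (2 * π) ^ Fintype.card ι * ∫ y : ℝ,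
          ((1 / (2 * cosh (y / 2)) : ℝ) : ℂ) ^ (Fintype.card ι + 1)
            * Complex.exp ((d / (2 * π) : ℝ) * y * Complex.I) := by
  set f : ℝ → ℂ := fun s => ((1 / (2 * cosh (s / 2)) : ℝ) : ℂ) with hf
  have hFint : Integrable (Function.uncurry fun (s : ι → ℝ) (y : ℝ) => ((∏ i, f (s i)) * f y) *
      Complex.exp (((d - ∑ i, s i) / (2 * π) : ℝ) * y * Complex.I)) (volume.prod volume) := by
    have hf' : Integrable f := integrable_inv_two_cosh.ofReal
    have hpi : Integrable (fun s : ι → ℝ => ∏ i, f (s i)) := Integrable.fintype_prod fun _ => hf'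
    refine (hpi.mul_prod hf').mul_bdd (c := 1) ?_
      (.of_forall fun p => (norm_cexp_mul_mul_I _ _).le)
    exact Continuous.aestronglyMeasurable (by fun_prop)
  calc
    _ = ∫ s : ι → ℝ, (2 * π : ℂ)⁻¹ * ∫ y : ℝ, ((∏ i, f (s i)) * f y) *
          Complex.exp (((d - ∑ i, s i) / (2 * π) : ℝ) * y * Complex.I) := by
      refine integral_congr_ae (.of_forall fun s => ?_)
      simp only [mul_assoc (∏ i, f (s i))]
      rw [integral_const_mul, inv_two_cosh_eq_integral]
      ring
    _ = (2 * π : ℂ)⁻¹ * ∫ y : ℝ, ∫ s : ι → ℝ, (f y * Complex.exp ((d / (2 * π) : ℝ) * y *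
          Complex.I)) * ∏ i, (f (s i) * Complex.exp ((-(y / (2 * π)) : ℝ) * s i * Complex.I)) := by
      rw [integral_const_mul, integral_integral_swap hFint]
      congr 1
      refine integral_congr_ae (.of_forall fun y => integral_congr_ae (.of_forall fun s => ?_))
      simp only [Finset.prod_mul_distrib, ← Complex.exp_sum]
      rw [mul_mul_mul_comm, ← Complex.exp_add, mul_comm (f y)]
      congr 2
      rw [← Finset.sum_mul, ← Finset.mul_sum]
      push_cast
      ring
    _ = _ := by
      rw [mul_assoc, ← integral_const_mul ((2 * π : ℂ) ^ _)]
      congr 1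
      refine integral_congr_ae (.of_forall fun y => ?_)
      simp only [integral_const_mul, hf, integral_prod_inv_two_cosh_mul_cexp]
      ring

/-- The Mirzakhani volume `V_{𝔸ₙ}(d)` of the moduli space of hyperbolic `n`-crowns
with fixed neck length `d`, for odd `n = 2k + 1`. -/
theorem crown_volume_fixed_neck_odd (k : ℕ) (d : ℝ) :
    (∫ s : Fin (2 * k) → ℝ,
        (∏ i, 1 / (2 * Real.cosh (s i / 2))) *
          (1 / (2 * Real.cosh ((d - ∑ i, s i) / 2))))
      = 1 / Real.cosh (d / 2) *
          (∏ j ∈ Finset.Icc 1 k, (d ^ 2 + (2 * (j : ℝ) - 1) ^ 2 * Real.pi ^ 2)) /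
          (2 * (Nat.factorial (2 * k) : ℝ)) := by
  have h := integral_prod_inv_two_cosh_eq_integral_pow (Fin (2 * k)) d
  rw [Fintype.card_fin, integral_inv_two_cosh_pow_odd_mul_cexp] at h
  simp only [← Complex.ofReal_prod, ← Complex.ofReal_mul] at h
  rw [integral_complex_ofReal] at h
  have hprod : ∏ j ∈ Finset.Icc 1 k, (d ^ 2 + (2 * (j : ℝ) - 1) ^ 2 * π ^ 2)
      = (2 * π) ^ (2 * k) *
        ∏ j ∈ Finset.Icc 1 k, ((d / (2 * π)) ^ 2 + (2 * (j : ℝ) - 1) ^ 2 / 4) := by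
    have : (2 * π) ^ (2 * k) = ∏ _j ∈ Finset.Icc 1 k, (2 * π) ^ 2 := by
      rw [Finset.prod_const, Nat.card_Icc, Nat.add_sub_cancel, pow_mul]
    rw [this, ← Finset.prod_mul_distrib]
    refine Finset.prod_congr rfl fun j _ => ?_
    field_simp
    ring
  have hc := (cosh_pos (d / 2)).ne'
  have hfac : (Nat.factorial (2 * k) : ℝ) ≠ 0 := by positivity
  rw [show π * (d / (2 * π)) = d / 2 by field_simp] at h
  rw [hprod]
  refine Complex.ofReal_injective (h.trans ?_)
  generalize ∏ j ∈ Finset.Icc 1 k, ((d / (2 * π)) ^ 2 + (2 * (j : ℝ) - 1) ^ 2 / 4) = P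
  generalize (Nat.factorial (2 * k) : ℝ) = N at hfac
  norm_cast
  field_simp
end

section
/- For every real number ξ, the integral ∫_ℝ cos(2π·ξ·x) / (2·cosh(x/2)) dx equals π / cosh(2π²·ξ). -/
open MeasureTheory Real

lemma sigmoid_eq_exp_sub_log_cosh (x : ℝ) :
    sigmoid x = exp (x / 2 - log (2 * cosh (x / 2))) := by
  have h : 0 < 2 * cosh (x / 2) := by positivity
  have h1 : exp (-x) = exp (-(x / 2)) / exp (x / 2) := by
    rw [← exp_sub]
    ring_nf
  rw [exp_sub, exp_log h, sigmoid_def, h1, cosh_eq]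
  field_simp

lemma one_sub_sigmoid_eq_exp_sub_log_cosh (x : ℝ) :
    1 - sigmoid x = exp (-(x / 2) - log (2 * cosh (x / 2))) := by
  rw [← sigmoid_neg, sigmoid_eq_exp_sub_log_cosh, neg_div, cosh_neg]

lemma ofReal_exp_cpow (a : ℝ) (c : ℂ) : ((exp a : ℝ) : ℂ) ^ c = Complex.exp (a * c) := by
  rw [Complex.cpow_def_of_ne_zero (by exact_mod_cast (exp_pos a).ne'), ← Complex.ofReal_log
    (exp_pos a).le, log_exp]

/-- The Beta integrand at `(1 / 2 + w i, 1 / 2 - w i)`, after the substitution `t = sigmoid x`. -/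
lemma abs_deriv_sigmoid_smul_beta_integrand (w x : ℝ) :
    |sigmoid x * (1 - sigmoid x)| •
      ((sigmoid x : ℂ) ^ ((1 / 2 + w * Complex.I : ℂ) - 1) *
        (1 - (sigmoid x : ℂ)) ^ ((1 / 2 - w * Complex.I : ℂ) - 1)) =
      Complex.exp ((w * x : ℝ) * Complex.I) / ((2 * cosh (x / 2) : ℝ) : ℂ) := by
  have h : 0 < 2 * cosh (x / 2) := by positivity
  have h2 : (1 - (sigmoid x : ℂ)) = ((1 - sigmoid x : ℝ) : ℂ) := by push_cast; rfl
  rw [h2, one_sub_sigmoid_eq_exp_sub_log_cosh, sigmoid_eq_exp_sub_log_cosh,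
    abs_of_pos (by positivity),
    ofReal_exp_cpow, ofReal_exp_cpow, Complex.real_smul]
  nth_rewrite 5 [← exp_log h]
  generalize log (2 * cosh (x / 2)) = L
  push_cast
  rw [← Complex.exp_add, ← Complex.exp_add, ← Complex.exp_add, ← Complex.exp_sub]
  ring_nf

lemma integrable_exp_mul_I_div_cosh (w : ℝ) :
    Integrable fun x : ℝ ↦
      Complex.exp ((w * x : ℝ) * Complex.I) / ((2 * cosh (x / 2) : ℝ) : ℂ) := by
  have h := Complex.betaIntegral_convergent (u := 1 / 2 + w * Complex.I)
    (v := 1 / 2 - w * Complex.I) (by simp) (by simp)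
  rw [intervalIntegrable_iff_integrableOn_Ioo_of_le zero_le_one, ← range_sigmoid,
    ← Set.image_univ, integrableOn_image_iff_integrableOn_abs_deriv_smul MeasurableSet.univ
      (fun x _ ↦ (hasDerivAt_sigmoid x).hasDerivWithinAt) sigmoid_injective.injOn,
    integrableOn_univ] at h
  simpa only [abs_deriv_sigmoid_smul_beta_integrand] using h

lemma integral_exp_mul_I_div_cosh (w : ℝ) :
    ∫ x : ℝ, Complex.exp ((w * x : ℝ) * Complex.I) / ((2 * cosh (x / 2) : ℝ) : ℂ) =
      ((π / cosh (π * w) : ℝ) : ℂ) := by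
  have h := Complex.betaIntegral_eq_Gamma_mul_div (1 / 2 + w * Complex.I)
    (1 / 2 - w * Complex.I) (by simp) (by simp)
  have h1 : (1 / 2 - w * Complex.I : ℂ) = 1 - (1 / 2 + w * Complex.I) := by ring
  have h2 : (π : ℂ) * (1 / 2 + w * Complex.I) = (π * w : ℂ) * Complex.I + π / 2 := by ring
  have h3 : Complex.Gamma (1 / 2 + w * Complex.I) * Complex.Gamma (1 / 2 - w * Complex.I) /
      Complex.Gamma ((1 / 2 + w * Complex.I) + (1 / 2 - w * Complex.I)) =
      ((π / cosh (π * w) : ℝ) : ℂ) := by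
    rw [h1, Complex.Gamma_mul_Gamma_one_sub, h2, Complex.sin_add_pi_div_two, Complex.cos_mul_I,
      add_sub_cancel, Complex.Gamma_one, div_one]
    push_cast
    rfl
  rw [h3, Complex.betaIntegral, intervalIntegral.integral_of_le zero_le_one,
    integral_Ioc_eq_integral_Ioo, ← range_sigmoid, ← Set.image_univ,
    integral_image_eq_integral_abs_deriv_smul MeasurableSet.univ
      (fun x _ ↦ (hasDerivAt_sigmoid x).hasDerivWithinAt) sigmoid_injective.injOn,
    setIntegral_univ] at h
  simpa only [abs_deriv_sigmoid_smul_beta_integrand] using h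

/-- The Fourier transform of `x ↦ 1/(2 cosh(x/2))` at frequency `ξ` is
`π / cosh(2π²ξ)`. -/
theorem fourier_sech (ξ : ℝ) :
    (∫ x : ℝ, Real.cos (2 * Real.pi * ξ * x) / (2 * Real.cosh (x / 2)))
      = Real.pi / Real.cosh (2 * Real.pi ^ 2 * ξ) := by
  have h := integral_re (integrable_exp_mul_I_div_cosh (2 * π * ξ))
  rw [integral_exp_mul_I_div_cosh] at h
  simp only [RCLike.re_eq_complex_re, Complex.div_ofReal_re, Complex.exp_ofReal_mul_I_re,
    Complex.ofReal_re] at h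
  rw [h]
  ring_nf
end

section
/- The triple series ∑_{a=1}^{∞} ∑_{b=1}^{∞} ∑_{c=1}^{∞} 1/(a·(a+b−1)·(b+c−1)·c) converges and its sum equals 3π⁴/40. -/
open Real

open Finset in
/-- The real-valued generalized harmonic number `∑_{i=1}^{n} 1/i^k`. -/
noncomputable def powerHarmonic (k n : ℕ) : ℝ := ∑ i ∈ range n, 1 / ((i : ℝ) + 1) ^ k

lemma powerHarmonic_zero (k : ℕ) : powerHarmonic k 0 = 0 := by
  simp [powerHarmonic]

lemma powerHarmonic_succ (k n : ℕ) :
    powerHarmonic k (n + 1) = powerHarmonic k n + 1 / ((n : ℝ) + 1) ^ k := by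
  simp [powerHarmonic, Finset.sum_range_succ]

lemma powerHarmonic_nonneg (k n : ℕ) : 0 ≤ powerHarmonic k n :=
  Finset.sum_nonneg fun _ _ => by positivity

/-- Iterated sums of a nonnegative function compute its sum over the product. -/
lemma HasSum.prod_of_nonneg {α β : Type*} {f : α × β → ℝ} {g : α → ℝ} {s : ℝ}
    (hf : ∀ p, 0 ≤ f p) (hfg : ∀ a, HasSum (fun b => f (a, b)) (g a)) (hg : HasSum g s) :
    HasSum f s := by
  have hsum : Summable f := by
    rw [summable_prod_of_nonneg hf]
    refine ⟨fun a => (hfg a).summable, ?_⟩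
    simpa only [(hfg _).tsum_eq] using hg.summable
  have := hsum.hasSum.prod_fiberwise hfg
  rw [← this.unique hg]
  exact hsum.hasSum

lemma HasSum.mul_prod_of_nonneg {f g : ℕ → ℝ} {s t : ℝ} (hf : HasSum f s) (hg : HasSum g t)
    (hf0 : ∀ n, 0 ≤ f n) (hg0 : ∀ n, 0 ≤ g n) :
    HasSum (fun p : ℕ × ℕ => f p.1 * g p.2) (s * t) :=
  hf.mul hg (hf.summable.mul_of_nonneg hg.summable hf0 hg0)

lemma Real.hasSum_succ_iff {f : ℕ → ℝ} {s : ℝ} :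
    HasSum (fun n => f (n + 1)) (s - f 0) ↔ HasSum f s := by
  simpa using hasSum_nat_add_iff' (f := f) (g := s) 1

lemma hasSum_one_div_sub_one_div_add_one (n : ℕ) :
    HasSum (fun j : ℕ => 1 / ((j : ℝ) + 1 + n) - 1 / ((j : ℝ) + 1 + (n + 1)))
      (1 / ((n : ℝ) + 1)) := by
  rw [hasSum_iff_tendsto_nat_of_nonneg]
  · have h (m : ℕ) : ∑ j ∈ Finset.range m,
        (1 / ((j : ℝ) + 1 + n) - 1 / ((j : ℝ) + 1 + (n + 1))) =
        1 / ((n : ℝ) + 1) - 1 / ((m : ℝ) + ((n : ℝ) + 1)) := by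
      convert Finset.sum_range_sub' (fun j : ℕ => 1 / ((j : ℝ) + ((n : ℝ) + 1))) m using 2
      · push_cast
        ring_nf
      · simp
    simp only [h]
    have hlim : Filter.Tendsto (fun m : ℕ => 1 / ((m : ℝ) + ((n : ℝ) + 1)))
        Filter.atTop (nhds 0) := by
      simp only [one_div]
      exact (Filter.tendsto_atTop_add_const_right _ _
        tendsto_natCast_atTop_atTop).inv_tendsto_atTop
    simpa using hlim.const_sub (1 / ((n : ℝ) + 1))
  · intro j
    rw [sub_nonneg]
    gcongr
    linarith

lemma hasSum_one_div_sub_one_div_add (n : ℕ) :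
    HasSum (fun j : ℕ => 1 / ((j : ℝ) + 1) - 1 / ((j : ℝ) + 1 + n)) (powerHarmonic 1 n) := by
  induction n with
  | zero => simp [powerHarmonic_zero]
  | succ n ih =>
    rw [powerHarmonic_succ, pow_one]
    convert ih.add (hasSum_one_div_sub_one_div_add_one n) using 2 with j
    push_cast
    ring

lemma hasSum_one_div_mul_add (n : ℕ) :
    HasSum (fun j : ℕ => 1 / (((j : ℝ) + 1) * ((j : ℝ) + 1 + (n + 1))))
      (powerHarmonic 1 (n + 1) / ((n : ℝ) + 1)) := by
  convert! (hasSum_one_div_sub_one_div_add (n + 1)).div_const ((n : ℝ) + 1) using 2 with j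
  push_cast
  field_simp
  ring

lemma sum_range_powerHarmonic_div (k m : ℕ) :
    ∑ i ∈ Finset.range m, powerHarmonic k (i + 1) / ((i : ℝ) + 1) ^ k =
      (powerHarmonic k m ^ 2 + powerHarmonic (2 * k) m) / 2 := by
  induction m with
  | zero => simp [powerHarmonic_zero]
  | succ m ih =>
    rw [Finset.sum_range_succ, ih]
    simp only [powerHarmonic_succ, pow_mul']
    field_simp
    ring

lemma sum_antidiagonal_one_div_mul (M : ℕ) :
    ∑ p ∈ Finset.HasAntidiagonal.antidiagonal M, 1 / (((p.1 : ℝ) + 1) * ((p.2 : ℝ) + 1)) =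
      2 * powerHarmonic 1 (M + 1) / ((M : ℝ) + 2) := by
  have h : ∑ p ∈ Finset.HasAntidiagonal.antidiagonal M, 1 / ((p.1 : ℝ) + 1) = powerHarmonic 1 (M + 1) := by
    simp [Finset.Nat.sum_antidiagonal_eq_sum_range_succ_mk, powerHarmonic]
  have h' : ∑ p ∈ Finset.HasAntidiagonal.antidiagonal M, 1 / ((p.2 : ℝ) + 1) = powerHarmonic 1 (M + 1) := by
    rw [← h, ← Finset.Nat.sum_antidiagonal_swap]
    rfl
  rw [two_mul]
  nth_rewrite 1 [← h]
  rw [← h', ← Finset.sum_add_distrib, Finset.sum_div]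
  refine Finset.sum_congr rfl fun p hp => ?_
  rw [Finset.HasAntidiagonal.mem_antidiagonal] at hp
  subst hp
  push_cast
  field_simp
  ring

lemma sum_antidiagonal_powerHarmonic_div (M : ℕ) :
    ∑ p ∈ Finset.HasAntidiagonal.antidiagonal M, powerHarmonic 1 (p.1 + 1) / ((p.2 : ℝ) + 1) =
      powerHarmonic 1 (M + 2) ^ 2 - powerHarmonic 2 (M + 2) := by
  induction M with
  | zero => norm_num [powerHarmonic, Finset.sum_range_succ]
  | succ M ih =>
    rw [Finset.Nat.sum_antidiagonal_succ]
    have h : ∑ p ∈ Finset.HasAntidiagonal.antidiagonal M, powerHarmonic 1 (p.1 + 1 + 1) / ((p.2 : ℝ) + 1) =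
        ∑ p ∈ Finset.HasAntidiagonal.antidiagonal M, powerHarmonic 1 (p.1 + 1) / ((p.2 : ℝ) + 1) +
        ∑ p ∈ Finset.HasAntidiagonal.antidiagonal M, 1 / (((p.1 : ℝ) + 2) * ((p.2 : ℝ) + 1)) := by
      rw [← Finset.sum_add_distrib]
      refine Finset.sum_congr rfl fun p _ => ?_
      rw [powerHarmonic_succ _ (p.1 + 1)]
      push_cast
      field_simp
      ring
    have h' := sum_antidiagonal_one_div_mul (M + 1)
    rw [Finset.Nat.sum_antidiagonal_succ] at h'
    push_cast at h'
    simp only [add_assoc, one_add_one_eq_two] at h' h ⊢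
    rw [h, ih, show M + (1 + 2) = M + 2 + 1 from rfl, powerHarmonic_succ 1 (M + 2),
      powerHarmonic_succ 2 (M + 2)]
    have h₁ : powerHarmonic 1 1 = 1 := by simp [powerHarmonic]
    simp only [zero_add, h₁]
    push_cast at h' ⊢
    have h₂ : ∑ p ∈ Finset.HasAntidiagonal.antidiagonal M, 1 / (((p.1 : ℝ) + 2) * ((p.2 : ℝ) + 1)) =
        2 * powerHarmonic 1 (M + 2) / (M + (1 + 2)) - 1 / ((M : ℝ) + 2) := by
      rw [← h']
      simp
    rw [h₂]
    field_simp
    ring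

lemma hasSum_one_div_succ_sq : HasSum (fun n : ℕ => 1 / ((n : ℝ) + 1) ^ 2) (π ^ 2 / 6) := by
  simpa using (hasSum_nat_add_iff' 1).mpr hasSum_zeta_two

lemma hasSum_one_div_succ_pow_four :
    HasSum (fun n : ℕ => 1 / ((n : ℝ) + 1) ^ 4) (π ^ 4 / 90) := by
  simpa using (hasSum_nat_add_iff' 1).mpr hasSum_zeta_four

lemma hasSum_powerHarmonic_two_div_sq :
    HasSum (fun n : ℕ => powerHarmonic 2 (n + 1) / ((n : ℝ) + 1) ^ 2) (7 * π ^ 4 / 360) := by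
  rw [hasSum_iff_tendsto_nat_of_nonneg
    fun n => div_nonneg (powerHarmonic_nonneg _ _) (by positivity)]
  simp only [sum_range_powerHarmonic_div]
  have h := ((hasSum_one_div_succ_sq.tendsto_sum_nat.pow 2).add
    hasSum_one_div_succ_pow_four.tendsto_sum_nat).div_const 2
  rw [show 7 * π ^ 4 / 360 = ((π ^ 2 / 6) ^ 2 + π ^ 4 / 90) / 2 by ring]
  exact h

lemma hasSum_powerHarmonic_one_div_cube :
    HasSum (fun n : ℕ => powerHarmonic 1 (n + 1) / ((n : ℝ) + 1) ^ 3) (π ^ 4 / 72) := by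
  have hprod : HasSum (fun p : ℕ × ℕ => 1 / ((p.1 : ℝ) + 1) ^ 2 * (1 / ((p.2 : ℝ) + 1) ^ 2))
      (π ^ 2 / 6 * (π ^ 2 / 6)) :=
    hasSum_one_div_succ_sq.mul_prod_of_nonneg hasSum_one_div_succ_sq
      (fun _ => by positivity) fun _ => by positivity
  let f : ℕ × ℕ → ℝ := fun p =>
    1 / ((p.1 : ℝ) + 1) ^ 2 * (1 / (((p.2 : ℝ) + 1) * ((p.2 : ℝ) + 1 + (p.1 + 1))))
  have hf : Summable f := by
    refine Summable.of_nonneg_of_le (fun p => by positivity) (fun p => ?_) hprod.summable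
    have hp : (0 : ℝ) ≤ p.1 := Nat.cast_nonneg _
    refine mul_le_mul_of_nonneg_left (one_div_le_one_div_of_le (by positivity) ?_) (by positivity)
    rw [pow_two]
    exact mul_le_mul_of_nonneg_left (by linarith) (by positivity)
  have hswap : HasSum (fun p : ℕ × ℕ => f p.swap) (∑' p, f p) :=
    (Equiv.prodComm ℕ ℕ).hasSum_iff.mpr hf.hasSum
  have hadd := (hf.hasSum.add hswap).unique (a₂ := π ^ 2 / 6 * (π ^ 2 / 6)) (by
    convert hprod using 2 with p
    simp only [f, Prod.fst_swap, Prod.snd_swap]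
    field_simp
    ring)
  have hval : ∑' p, f p = π ^ 4 / 72 := by linarith
  have hfib := hf.hasSum.prod_fiberwise
    fun n => (hasSum_one_div_mul_add n).mul_left (1 / ((n : ℝ) + 1) ^ 2)
  rw [hval] at hfib
  convert hfib using 2 with n
  field_simp

lemma summable_powerHarmonic_one_div_sq :
    Summable (fun n : ℕ => (powerHarmonic 1 (n + 1) / ((n : ℝ) + 1)) ^ 2) := by
  have hs : Summable (fun n : ℕ => 25 * (1 / (((n + 1 : ℕ) : ℝ) ^ (3 / 2 : ℝ)))) :=
    ((summable_nat_add_iff 1).mpr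
      (Real.summable_one_div_nat_rpow.mpr (by norm_num : (1 : ℝ) < 3 / 2))).mul_left 25
  refine Summable.of_nonneg_of_le (fun n => by positivity) (fun n => ?_) hs
  have hH : powerHarmonic 1 (n + 1) ≤ 5 * ((n + 1 : ℕ) : ℝ) ^ (1 / 4 : ℝ) := by
    have h₁ := harmonic_le_one_add_log (n + 1)
    have h₂ : ((harmonic (n + 1) : ℚ) : ℝ) = powerHarmonic 1 (n + 1) := by
      simp [harmonic, powerHarmonic]
    have h₃ := Real.log_le_rpow_div (x := ((n + 1 : ℕ) : ℝ)) (by positivity)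
      (by norm_num : (0 : ℝ) < 1 / 4)
    have h₄ : 1 ≤ ((n + 1 : ℕ) : ℝ) ^ (1 / 4 : ℝ) :=
      Real.one_le_rpow (by simp) (by norm_num)
    rw [h₂] at h₁
    linarith
  have hpos : (0 : ℝ) < ((n + 1 : ℕ) : ℝ) := by positivity
  have hsq : (((n + 1 : ℕ) : ℝ) ^ (1 / 4 : ℝ)) ^ 2 * ((n + 1 : ℕ) : ℝ) ^ (3 / 2 : ℝ) =
      ((n + 1 : ℕ) : ℝ) ^ 2 := by
    rw [← Real.rpow_mul_natCast hpos.le, ← Real.rpow_add hpos, ← Real.rpow_natCast]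
    norm_num
  rw [div_pow, ← Nat.cast_succ, mul_one_div, div_le_div_iff₀ (by positivity) (by positivity),
    ← hsq]
  calc powerHarmonic 1 (n + 1) ^ 2 * ((n + 1 : ℕ) : ℝ) ^ (3 / 2 : ℝ)
      ≤ (5 * ((n + 1 : ℕ) : ℝ) ^ (1 / 4 : ℝ)) ^ 2 * ((n + 1 : ℕ) : ℝ) ^ (3 / 2 : ℝ) := by
        gcongr
        exact powerHarmonic_nonneg _ _
    _ = _ := by ring

lemma sum_antidiagonal_powerHarmonic_mul (M : ℕ) :
    ∑ p ∈ Finset.HasAntidiagonal.antidiagonal M, powerHarmonic 1 (p.1 + 1) / ((p.1 : ℝ) + 1) *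
      (1 / (((p.2 : ℝ) + 1) * ((p.2 : ℝ) + 1 + (p.1 + 1)))) =
    3 / 2 * (powerHarmonic 1 (M + 2) / ((M : ℝ) + 2)) ^ 2
      - powerHarmonic 1 (M + 2) / ((M : ℝ) + 2) ^ 3
      - 1 / 2 * (powerHarmonic 2 (M + 2) / ((M : ℝ) + 2) ^ 2) := by
  have h₁ := sum_range_powerHarmonic_div 1 (M + 1)
  have h₂ := sum_antidiagonal_powerHarmonic_div M
  rw [← Finset.Nat.sum_antidiagonal_eq_sum_range_succ_mk
    (fun p : ℕ × ℕ => powerHarmonic 1 (p.1 + 1) / ((p.1 : ℝ) + 1) ^ 1)] at h₁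
  have h : ∑ p ∈ Finset.HasAntidiagonal.antidiagonal M, powerHarmonic 1 (p.1 + 1) / ((p.1 : ℝ) + 1) *
      (1 / (((p.2 : ℝ) + 1) * ((p.2 : ℝ) + 1 + (p.1 + 1)))) =
      (∑ p ∈ Finset.HasAntidiagonal.antidiagonal M, powerHarmonic 1 (p.1 + 1) / ((p.1 : ℝ) + 1) ^ 1 +
      ∑ p ∈ Finset.HasAntidiagonal.antidiagonal M, powerHarmonic 1 (p.1 + 1) / ((p.2 : ℝ) + 1)) /
        ((M : ℝ) + 2) ^ 2 := by
    rw [← Finset.sum_add_distrib, Finset.sum_div]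
    refine Finset.sum_congr rfl fun p hp => ?_
    rw [Finset.HasAntidiagonal.mem_antidiagonal] at hp
    subst hp
    push_cast
    field_simp
    ring
  rw [h, h₁, h₂, powerHarmonic_succ 1 (M + 1), powerHarmonic_succ 2 (M + 1)]
  push_cast
  rw [add_assoc (M : ℝ) 1 1, one_add_one_eq_two]
  field_simp
  ring

/-- The quadratic Euler sum `∑ (Hₙ/n)² = 17π⁴/360`. -/
lemma hasSum_powerHarmonic_one_div_sq :
    HasSum (fun n : ℕ => (powerHarmonic 1 (n + 1) / ((n : ℝ) + 1)) ^ 2) (17 * π ^ 4 / 360) := by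
  obtain ⟨A, hA⟩ := summable_powerHarmonic_one_div_sq
  have hU : HasSum (fun p : ℕ × ℕ => powerHarmonic 1 (p.1 + 1) / ((p.1 : ℝ) + 1) *
      (1 / (((p.2 : ℝ) + 1) * ((p.2 : ℝ) + 1 + (p.1 + 1))))) A := by
    refine HasSum.prod_of_nonneg (fun p => ?_) (fun n => ?_) hA
    · have := powerHarmonic_nonneg 1 (p.1 + 1)
      positivity
    · rw [pow_two]
      exact (hasSum_one_div_mul_add n).mul_left _
  have hdiag := ((Finset.HasAntidiagonal.sigmaAntidiagonalEquivProd (A := ℕ)).hasSum_iff.mpr hU).sigma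
    fun M => hasSum_fintype _
  have hcomb := ((hA.mul_left (3 / 2)).sub hasSum_powerHarmonic_one_div_cube).sub
    (hasSum_powerHarmonic_two_div_sq.mul_left (1 / 2))
  have hshift := Real.hasSum_succ_iff.mpr hcomb
  have heq := hdiag.unique (a₂ := 3 / 2 * A - π ^ 4 / 72 - 1 / 2 * (7 * π ^ 4 / 360)) (by
    convert hshift using 1
    · funext M
      simp only [Function.comp_apply, Finset.HasAntidiagonal.sigmaAntidiagonalEquivProd_apply]
      rw [Finset.univ_eq_attach, Finset.sum_attach (Finset.HasAntidiagonal.antidiagonal M) fun p : ℕ × ℕ =>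
        powerHarmonic 1 (p.1 + 1) / ((p.1 : ℝ) + 1) *
          (1 / (((p.2 : ℝ) + 1) * ((p.2 : ℝ) + 1 + (p.1 + 1)))),
        sum_antidiagonal_powerHarmonic_mul]
      push_cast
      simp only [add_assoc, one_add_one_eq_two]
    · norm_num [powerHarmonic])
  have hval : A = 17 * π ^ 4 / 360 := by linarith
  rwa [hval] at hA

lemma summable_one_div_mul_add (n : ℕ) :
    Summable (fun j : ℕ => 1 / (((j : ℝ) + 1) * ((j : ℝ) + 1 + n))) := by
  refine Summable.of_nonneg_of_le (fun j => by positivity) (fun j => ?_)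
    hasSum_one_div_succ_sq.summable
  have hn : (0 : ℝ) ≤ n := Nat.cast_nonneg _
  refine one_div_le_one_div_of_le (by positivity) ?_
  rw [pow_two]
  exact mul_le_mul_of_nonneg_left (by linarith) (by positivity)

lemma hasSum_tsum_one_div_mul_add_sq :
    HasSum (fun n : ℕ => (∑' j : ℕ, 1 / (((j : ℝ) + 1) * ((j : ℝ) + 1 + n))) ^ 2)
      (3 * π ^ 4 / 40) := by
  have h₀ : ∑' j : ℕ, 1 / (((j : ℝ) + 1) * ((j : ℝ) + 1 + (0 : ℕ))) = π ^ 2 / 6 := by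
    simpa [pow_two] using hasSum_one_div_succ_sq.tsum_eq
  have h₁ (n : ℕ) : ∑' j : ℕ, 1 / (((j : ℝ) + 1) * ((j : ℝ) + 1 + (n + 1 : ℕ))) =
      powerHarmonic 1 (n + 1) / ((n : ℝ) + 1) := by
    simpa using (hasSum_one_div_mul_add n).tsum_eq
  rw [← Real.hasSum_succ_iff]
  simp only [h₀, h₁]
  rw [show 3 * π ^ 4 / 40 - (π ^ 2 / 6) ^ 2 = 17 * π ^ 4 / 360 by ring]
  exact hasSum_powerHarmonic_one_div_sq

/-- The Mirzakhani volume `V_{𝔻₇}` of the moduli space of ideal heptagons: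
`∑_{a,b,c ≥ 1} 1/(a(a+b-1)(b+c-1)c) = 3π⁴/40`. -/
theorem heptagon_volume :
    HasSum
      (fun p : ℕ × ℕ × ℕ =>
        1 / (((p.1 : ℝ) + 1) * (((p.1 : ℝ) + 1) + ((p.2.1 : ℝ) + 1) - 1) *
          (((p.2.1 : ℝ) + 1) + ((p.2.2 : ℝ) + 1) - 1) * ((p.2.2 : ℝ) + 1)))
      (3 * Real.pi ^ 4 / 40) := by
  have htriple : HasSum (fun q : ℕ × ℕ × ℕ =>
      1 / (((q.2.1 : ℝ) + 1) * ((q.2.1 : ℝ) + 1 + q.1)) *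
        (1 / (((q.2.2 : ℝ) + 1) * ((q.2.2 : ℝ) + 1 + q.1)))) (3 * π ^ 4 / 40) := by
    refine HasSum.prod_of_nonneg (fun q => by positivity) (fun n => ?_)
      hasSum_tsum_one_div_mul_add_sq
    have h := (summable_one_div_mul_add n).hasSum
    have hmul := h.mul_prod_of_nonneg h (fun _ => by positivity) fun _ => by positivity
    rw [pow_two]
    exact hmul
  let e : ℕ × ℕ × ℕ ≃ ℕ × ℕ × ℕ :=
    { toFun := fun p => (p.2.1, p.1, p.2.2)
      invFun := fun p => (p.2.1, p.1, p.2.2)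
      left_inv := fun _ => rfl
      right_inv := fun _ => rfl }
  convert! e.hasSum_iff.mpr htriple using 2 with p
  simp only [e, Function.comp_apply, Equiv.coe_fn_mk]
  rw [one_div_mul_one_div]
  ring_nf
end
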